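/- Let G be an extension of a free group F of finite rank n ≥ 2 by an infinite cyclic group ⟨a⟩, and let α be the induced automorphism of A = F/[F,F]. If there exist m, M ∈ ℕ with M ≥ 2 such that (α − id)^m(A) ⊆ M·A, then γ_{ω²}(G) = 1; in particular the transfinite lower central series of G has length at most ω². -/

import Mathlib

/-- The transfinite lower central series of a group: `γ_0 = ⊤`, `γ_{o+1} = [γ_o, G]`, and
`γ_λ = ⨅_{o < λ} γ_o` at limit ordinals (indexing shifted by one from the paper's `γ_1 = G`). -/
noncomputable def transfiniteLCS (G : Type*) [Group G] (o : Ordinal) : Subgroup G :=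
  Ordinal.limitRecOn o ⊤ (fun _ ih => ⁅ih, (⊤ : Subgroup G)⁆)
    (fun o _ ih => ⨅ (o' : Ordinal) (h : o' < o), ih o' h)

section MagnusRepresentation

variable {ι : Type*} [DecidableEq ι] {C : Type*} [CommRing C]

/-- The unit `u` acts on functions on words: in the dual basis it fixes the words not beginning
with `i` up to a multiple `u - 1` of the word extended by `i`, and scales by `u` the words beginning
with `i`. -/
def letterEnd (i : ι) (u : C) : Module.End C (List ι → C) where
  toFun x w :=
    if w.head? = some i then u * x w + if w.tail.head? = some i then 0 else (u - 1) * x w.tail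
    else x w
  map_add' x y := by
    ext w; simp only [Pi.add_apply]; split_ifs <;> ring
  map_smul' c x := by
    ext w; simp only [Pi.smul_apply, smul_eq_mul, RingHom.id_apply]; split_ifs <;> ring

theorem letterEnd_apply (i : ι) (u : C) (x : List ι → C) (w : List ι) :
    letterEnd i u x w =
      if w.head? = some i then u * x w + if w.tail.head? = some i then 0 else (u - 1) * x w.tail
      else x w := rfl

/-- The action of `letterEnd` as a monoid homomorphism in the unit. -/
def letterRep (i : ι) : C →* Module.End C (List ι → C) where
  toFun := letterEnd i
  map_one' := by
    ext1 x; ext w; simp [letterEnd_apply]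
  map_mul' u v := by
    ext x w
    simp only [Module.End.mul_apply, letterEnd_apply]
    split_ifs <;> ring

/-- The representation of a free product on functions on words attached to characters of the
factors. -/
def coprodRep {H : ι → Type*} [∀ i, Group (H i)] (χ : ∀ i, H i →* Cˣ) :
    Monoid.CoprodI H →* Module.End C (List ι → C) :=
  Monoid.CoprodI.lift fun i => (letterRep i).comp ((Units.coeHom C).comp (χ i))

theorem coprodRep_of {H : ι → Type*} [∀ i, Group (H i)] (χ : ∀ i, H i →* Cˣ) {i : ι} (h : H i) :
    coprodRep χ (Monoid.CoprodI.of h) = letterEnd i (χ i h : C) := by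
  simp only [coprodRep, Monoid.CoprodI.lift_of]; rfl

theorem coprodRep_list_apply {H : ι → Type*} [∀ i, Group (H i)] (χ : ∀ i, H i →* Cˣ)
    (l : List (Σ i, H i)) (hl : l.IsChain fun a b => a.1 ≠ b.1) :
    coprodRep χ (l.map fun a => Monoid.CoprodI.of a.2).prod (Pi.single [] 1) (l.map Sigma.fst) =
        (l.map fun a => (χ a.1 a.2 : C) - 1).prod ∧
      ∀ w : List ι, l.length ≤ w.length → w ≠ l.map Sigma.fst →
        coprodRep χ (l.map fun a => Monoid.CoprodI.of a.2).prod (Pi.single [] 1) w = 0 := by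
  induction l with
  | nil => simp +contextual
  | cons a l ih =>
    obtain ⟨ih₁, ih₂⟩ := ih hl.of_cons
    have hne : (l.map Sigma.fst).head? ≠ some a.1 := by
      cases l with
      | nil => simp
      | cons b l => simpa [eq_comm] using (List.isChain_cons_cons.1 hl).1
    simp only [List.map_cons, List.prod_cons, map_mul, Module.End.mul_apply, coprodRep_of,
      letterEnd_apply]
    constructor
    · rw [ih₂ (a.1 :: l.map Sigma.fst) (by simp) (by simp)]
      simp only [List.head?_cons, List.tail_cons, if_true, if_neg hne, ih₁, mul_zero, zero_add]
    · intro w hw hwne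
      rw [List.length_cons] at hw
      rw [ih₂ w (by omega) (by rintro rfl; simp at hw)]
      cases w with
      | nil => simp at hw
      | cons j w =>
        by_cases hj : j = a.1
        · subst hj
          simp only [List.length_cons] at hw
          rw [List.tail_cons, ih₂ w (by omega) (by rintro rfl; exact hwne rfl)]
          simp
        · simp [hj]

/-- Endomorphisms of a function module raising the `t`-adic filtration by `k` steps. -/
def raisingEnd (K : Type*) [CommRing K] [Algebra K C] (X : Type*) (t : C) (k : ℕ) :
    Submodule K (Module.End C (X → C)) where
  carrier := {T | ∀ j x, (∀ w, t ^ j ∣ x w) → ∀ w, t ^ (j + k) ∣ T x w}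
  zero_mem' := by intro j x _ w; simp
  add_mem' := by
    intro S T hS hT j x hx w
    exact dvd_add (hS j x hx w) (hT j x hx w)
  smul_mem' := fun c T hT j x hx w => by
    rw [LinearMap.smul_apply, Pi.smul_apply, Algebra.smul_def]
    exact (hT j x hx w).mul_left _

theorem raisingEnd_mul {K : Type*} [CommRing K] [Algebra K C] {X : Type*} {t : C} {k l : ℕ}
    {S T : Module.End C (X → C)} (hS : S ∈ raisingEnd K X t k) (hT : T ∈ raisingEnd K X t l) :
    S * T ∈ raisingEnd K X t (l + k) := fun j x hx w => by
  rw [← add_assoc]; exact hS _ _ (hT j x hx) w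

theorem raisingEnd_pow_le {K : Type*} [CommRing K] [Algebra K C] {X : Type*} {t : C} (k : ℕ) :
    raisingEnd K X t 1 ^ k ≤ raisingEnd K X t k := by
  induction k with
  | zero =>
    rw [pow_zero, Submodule.one_le]
    intro j x hx w
    simpa using hx w
  | succ k ih =>
    rw [pow_succ', Submodule.mul_le]
    exact fun S hS T hT => raisingEnd_mul hS (ih hT)

theorem coprodRep_sub_one_mem {K : Type*} [CommRing K] [Algebra K C] {H : ι → Type*}
    [∀ i, Group (H i)] (χ : ∀ i, H i →* Cˣ) {t : C} (ht : ∀ i h, t ∣ (χ i h : C) - 1)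
    (g : Monoid.CoprodI H) : coprodRep χ g - 1 ∈ raisingEnd K (List ι) t 1 := by
  induction g using Monoid.CoprodI.induction_on with
  | one => simp
  | of i h =>
    intro j x hx w
    rw [coprodRep_of, LinearMap.sub_apply, Pi.sub_apply, letterEnd_apply, Module.End.one_apply]
    have key : ∀ y, t ^ j ∣ y → t ^ (j + 1) ∣ ((χ i h : C) - 1) * y := fun y hy => by
      rw [pow_succ']; exact mul_dvd_mul (ht i h) hy
    split_ifs
    · convert key _ (hx w) using 1; ring
    · convert key _ (dvd_add (hx w) (hx w.tail)) using 1; ring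
    · simp
  | mul g h hg hh =>
    have : coprodRep χ (g * h) - 1 =
        (coprodRep χ g - 1) * (coprodRep χ h - 1) + (coprodRep χ g - 1) + (coprodRep χ h - 1) := by
      rw [map_mul]; simp only [sub_mul, mul_sub, one_mul, mul_one]; abel
    rw [this]
    refine add_mem (add_mem ?_ hg) hh
    intro j x hx w
    exact (pow_dvd_pow t (by omega)).trans (raisingEnd_mul hg hh j x hx w)

end MagnusRepresentation

/-- The augmentation ideal of a group algebra. -/
noncomputable def augmentation (K F : Type*) [CommRing K] [Group F] :
    Submodule K (MonoidAlgebra K F) :=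
  Submodule.span K (Set.range fun f => MonoidAlgebra.of K F f - 1)

theorem of_sub_one_mem_augmentation (K : Type*) {F : Type*} [CommRing K] [Group F] (f : F) :
    MonoidAlgebra.of K F f - 1 ∈ augmentation K F :=
  Submodule.subset_span ⟨f, rfl⟩

theorem PowerSeries.one_add_X_pow_ne_one {K : Type*} [CommRing K] [Nontrivial K] {n : ℕ}
    (hn : n ≠ 0) : (1 + PowerSeries.X : PowerSeries K) ^ n ≠ 1 := by
  intro h
  have h' : (1 + Polynomial.X : Polynomial K) ^ n = 1 := by
    apply Polynomial.coe_injective K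
    simpa using h
  have hm : (1 + Polynomial.X : Polynomial K).Monic := by
    rw [add_comm]; exact Polynomial.monic_X_add_C (1 : K)
  have hd : (1 + Polynomial.X : Polynomial K).natDegree = 1 := by
    rw [add_comm]; exact Polynomial.natDegree_X_add_C (1 : K)
  have := hm.natDegree_pow n
  rw [h', hd] at this
  simp at this
  exact hn this.symm

theorem eq_one_of_forall_mem_augmentation_pow (K : Type*) [Field K] {F ι : Type*} [Group F]
    (e : F ≃* FreeGroup ι) {f : F}
    (hf : ∀ k ≠ 0, MonoidAlgebra.of K F f - 1 ∈ augmentation K F ^ k) : f = 1 := by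
  classical
  obtain ⟨u, hu⟩ : IsUnit (1 + PowerSeries.X : PowerSeries K) := by
    rw [PowerSeries.isUnit_iff_constantCoeff]; simp
  let χ : FreeGroup Unit →* (PowerSeries K)ˣ := FreeGroup.lift fun _ => u
  have hχ : ∀ h, ∃ z : ℤ, h = FreeGroup.of () ^ z ∧ χ h = u ^ z := fun h => by
    refine ⟨FreeGroup.freeGroupUnitEquivInt h, ?_, ?_⟩
    · exact (FreeGroup.freeGroupUnitEquivInt.symm_apply_apply h).symm
    · conv_lhs => rw [← FreeGroup.freeGroupUnitEquivInt.symm_apply_apply h]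
      simp [χ, FreeGroup.freeGroupUnitEquivInt]
  have hχ_inj : ∀ h, h ≠ 1 → (χ h : PowerSeries K) - 1 ≠ 0 := by
    intro h hh h0
    obtain ⟨z, rfl, hz⟩ := hχ h
    have huf : ¬ IsOfFinOrder u := by
      rw [isOfFinOrder_iff_pow_eq_one]
      rintro ⟨n, hn, h1⟩
      apply PowerSeries.one_add_X_pow_ne_one (K := K) hn.ne'
      rw [← hu, ← Units.val_pow_eq_pow_val, h1, Units.val_one]
    have h1 : u ^ z = u ^ (0 : ℤ) := by
      rw [← hz, zpow_zero]; exact Units.ext (sub_eq_zero.1 h0)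
    rw [injective_zpow_iff_not_isOfFinOrder.2 huf h1] at hh
    simp at hh
  have hχ_dvd : ∀ h, (PowerSeries.X : PowerSeries K) ∣ (χ h : PowerSeries K) - 1 := by
    intro h
    rw [PowerSeries.X_dvd_iff, map_sub, map_one, sub_eq_zero]
    obtain ⟨z, -, hz⟩ := hχ h
    have : Units.map (PowerSeries.constantCoeff (R := K)).toMonoidHom u = 1 := by
      ext; simp [hu]
    have h2 := congrArg (Units.map (PowerSeries.constantCoeff (R := K)).toMonoidHom) hz
    rw [map_zpow, this, one_zpow] at h2
    simpa using congrArg Units.val h2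
  let ψ : F ≃* Monoid.CoprodI fun _ : ι => FreeGroup Unit := e.trans freeGroupEquivCoprodI
  let ρ := coprodRep fun _ : ι => χ
  let Φ := MonoidAlgebra.lift K (Module.End (PowerSeries K) (List ι → PowerSeries K)) F
    (ρ.comp ψ.toMonoidHom)
  have hΦ : ∀ k, augmentation K F ^ k ≤
      (raisingEnd K (List ι) (PowerSeries.X : PowerSeries K) k).comap Φ.toLinearMap := by
    intro k
    rw [← Submodule.map_le_iff_le_comap, Submodule.map_pow]
    refine le_trans (pow_le_pow_left' ?_ k) (raisingEnd_pow_le k)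
    rw [Submodule.map_le_iff_le_comap, augmentation, Submodule.span_le]
    rintro _ ⟨g, rfl⟩
    have := coprodRep_sub_one_mem (K := K) (fun _ : ι => χ) (fun _ => hχ_dvd) (ψ g)
    simpa [Φ, ρ] using this
  have hzero : (ρ (ψ f) - 1) (Pi.single [] 1) = 0 := by
    ext w m
    rw [Pi.zero_apply, map_zero]
    have h1 := hΦ (m + 1) (hf (m + 1) m.succ_ne_zero) 0 (Pi.single [] 1) (fun _ => by simp) w
    refine PowerSeries.X_pow_dvd_iff.1 ?_ m (Nat.lt_add_left 0 m.lt_succ_self)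
    simpa [Φ] using h1
  by_contra hne
  set W := Monoid.CoprodI.Word.equiv (ψ f) with hW
  have hWf : W.prod = ψ f := Monoid.CoprodI.Word.equiv.symm_apply_apply (ψ f)
  obtain ⟨h1, -⟩ := coprodRep_list_apply (fun _ : ι => χ) W.toList W.chain_ne
  have hnil : W.toList ≠ [] := by
    intro h0
    apply hne
    rw [← map_eq_one_iff ψ ψ.injective, ← hWf, Monoid.CoprodI.Word.prod, h0]
    simp
  have h2 := congrFun hzero (W.toList.map Sigma.fst)
  rw [← hWf, LinearMap.sub_apply, Pi.sub_apply, Module.End.one_apply,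
    Pi.single_eq_of_ne (by simpa using hnil), sub_zero] at h2
  have h3 := h1.symm.trans h2
  rw [Pi.zero_apply, List.prod_eq_zero_iff, List.mem_map] at h3
  obtain ⟨a, ha, h0⟩ := h3
  exact hχ_inj _ (W.ne_one a ha) h0

section Augmentation

variable {K F : Type*} [CommRing K] [Group F]

theorem augmentation_mul_le : augmentation K F * augmentation K F ≤ augmentation K F := by
  rw [augmentation, Submodule.span_mul_span, Submodule.span_le]
  rintro _ ⟨_, ⟨f, rfl⟩, _, ⟨g, rfl⟩, rfl⟩
  have : (MonoidAlgebra.of K F f - 1) * (MonoidAlgebra.of K F g - 1) =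
      (MonoidAlgebra.of K F (f * g) - 1) - (MonoidAlgebra.of K F f - 1) -
        (MonoidAlgebra.of K F g - 1) := by
    rw [map_mul]; simp only [sub_mul, mul_sub, one_mul, mul_one]; abel
  show (MonoidAlgebra.of K F f - 1) * (MonoidAlgebra.of K F g - 1) ∈ augmentation K F
  rw [this]
  exact sub_mem (sub_mem (of_sub_one_mem_augmentation K _) (of_sub_one_mem_augmentation K _))
    (of_sub_one_mem_augmentation K _)

theorem augmentation_pow_succ_le {k : ℕ} (hk : k ≠ 0) :
    augmentation K F ^ (k + 1) ≤ augmentation K F ^ k := by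
  obtain ⟨k, rfl⟩ := Nat.exists_eq_succ_of_ne_zero hk
  rw [Nat.succ_eq_add_one, pow_succ _ (k + 1), pow_succ, mul_assoc]
  exact mul_le_mul' le_rfl augmentation_mul_le

/-- The endomorphism of the group algebra induced by an automorphism of the group. -/
noncomputable def autAlgHom (K : Type*) {F : Type*} [CommRing K] [Group F] (φ : MulAut F) :
    MonoidAlgebra K F →ₐ[K] MonoidAlgebra K F :=
  MonoidAlgebra.mapDomainAlgHom K K φ.toMonoidHom

theorem autAlgHom_of (φ : MulAut F) (f : F) :
    autAlgHom K φ (MonoidAlgebra.of K F f) = MonoidAlgebra.of K F (φ f) := by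
  simp [autAlgHom]

theorem autAlgHom_one : autAlgHom K (1 : MulAut F) = AlgHom.id K _ :=
  MonoidAlgebra.algHom_ext' (MonoidHom.ext fun f => by simp [autAlgHom]) (by ext)

theorem autAlgHom_mul (φ ψ : MulAut F) :
    autAlgHom K (φ * ψ) = (autAlgHom K φ).comp (autAlgHom K ψ) :=
  MonoidAlgebra.algHom_ext' (MonoidHom.ext fun f => by simp [autAlgHom]) (by ext)

theorem autAlgHom_mul_apply (φ ψ : MulAut F) (z : MonoidAlgebra K F) :
    autAlgHom K (φ * ψ) z = autAlgHom K φ (autAlgHom K ψ z) := by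
  rw [autAlgHom_mul, AlgHom.comp_apply]

theorem autAlgHom_toLinearMap_pow (φ : MulAut F) (n : ℕ) :
    (autAlgHom K φ).toLinearMap ^ n = (autAlgHom K (φ ^ n)).toLinearMap := by
  induction n with
  | zero => rw [pow_zero, pow_zero, autAlgHom_one]; rfl
  | succ n ih => rw [pow_succ, pow_succ, autAlgHom_mul, ih]; rfl

theorem autAlgHom_mem (φ : MulAut F) {k : ℕ} {z : MonoidAlgebra K F}
    (hz : z ∈ augmentation K F ^ k) : autAlgHom K φ z ∈ augmentation K F ^ k := by
  have h : (augmentation K F).map (autAlgHom K φ).toLinearMap ≤ augmentation K F := by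
    rw [Submodule.map_le_iff_le_comap, augmentation, Submodule.span_le]
    rintro _ ⟨f, rfl⟩
    show autAlgHom K φ (MonoidAlgebra.of K F f - 1) ∈ augmentation K F
    rw [map_sub, map_one, autAlgHom_of]
    exact of_sub_one_mem_augmentation K _
  refine pow_le_pow_left' h k ?_
  rw [← Submodule.map_pow]
  exact Submodule.mem_map_of_mem hz

theorem autAlgHom_sub_self_mem (φ : MulAut F)
    (hφ : ∀ f, autAlgHom K φ (MonoidAlgebra.of K F f - 1) - (MonoidAlgebra.of K F f - 1) ∈
      augmentation K F ^ 2) {k : ℕ} {z : MonoidAlgebra K F} (hz : z ∈ augmentation K F ^ k) :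
    autAlgHom K φ z - z ∈ augmentation K F ^ (k + 1) := by
  have h1 : augmentation K F ≤ (augmentation K F ^ 2).comap ((autAlgHom K φ).toLinearMap - 1) := by
    rw [augmentation, Submodule.span_le]
    rintro _ ⟨f, rfl⟩
    exact hφ f
  induction hz using Submodule.pow_induction_on_left' with
  | algebraMap r => rw [AlgHom.commutes, sub_self]; exact zero_mem _
  | add x y i hx hy ihx ihy =>
    rw [map_add, add_sub_add_comm]; exact add_mem ihx ihy
  | mem_mul u hu i v hv ih =>
    have : autAlgHom K φ (u * v) - u * v =
        (autAlgHom K φ u - u) * autAlgHom K φ v + u * (autAlgHom K φ v - v) := by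
      rw [map_mul, sub_mul, mul_sub]; abel
    rw [this]
    refine add_mem ?_ ?_
    · rw [Nat.succ_eq_add_one, add_assoc, add_comm, pow_add]
      exact Submodule.mul_mem_mul (h1 hu) (autAlgHom_mem φ hv)
    · rw [Nat.succ_eq_add_one, pow_succ']
      exact Submodule.mul_mem_mul hu ih

theorem pow_apply_mem_augmentation_pow {φ : MulAut F} {k : ℕ} (n : ℕ) {z : MonoidAlgebra K F}
    (hz : z ∈ augmentation K F ^ k) :
    (((autAlgHom K φ).toLinearMap - 1) ^ n) z ∈ augmentation K F ^ k := by
  induction n with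
  | zero => exact hz
  | succ n ih => rw [pow_succ']; exact sub_mem (autAlgHom_mem φ ih) ih

theorem exists_pow_apply_mem_augmentation_pow_succ (p : ℕ) [Fact p.Prime] [CharP K p]
    [Nontrivial K] {φ : MulAut F} {m : ℕ}
    (hφ : ∀ f, (((autAlgHom K φ).toLinearMap - 1) ^ m) (MonoidAlgebra.of K F f - 1) ∈
      augmentation K F ^ 2) :
    ∃ q : ℕ, ∀ k, ∀ z ∈ augmentation K F ^ k,
      (((autAlgHom K φ).toLinearMap - 1) ^ q) z ∈ augmentation K F ^ (k + 1) := by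
  have : CharP (Module.End K (MonoidAlgebra K F)) p :=
    charP_of_injective_algebraMap (R := K) (fun a b hab => by
      have := congrArg (fun T : Module.End K (MonoidAlgebra K F) => T 1) hab
      simpa [MonoidAlgebra.one_def, Module.algebraMap_end_apply,
        MonoidAlgebra.single_right_inj] using this) p
  have hpow : ((autAlgHom K φ).toLinearMap - 1) ^ p ^ m =
      (autAlgHom K (φ ^ p ^ m)).toLinearMap - 1 := by
    rw [sub_pow_char_pow_of_commute p m (Commute.one_right _), one_pow, autAlgHom_toLinearMap_pow]
  refine ⟨p ^ m, fun k z hz => ?_⟩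
  rw [hpow]
  refine autAlgHom_sub_self_mem (φ ^ p ^ m) (fun f => ?_) hz
  have hm : m ≤ p ^ m := (Nat.lt_pow_self (Fact.out : p.Prime).one_lt).le
  have := pow_apply_mem_augmentation_pow (φ := φ) (p ^ m - m) (hφ f)
  rwa [← Module.End.mul_apply, ← pow_add, Nat.sub_add_cancel hm, hpow] at this

/-- The elements `f` with `f - 1` in a submodule stable under left multiplication by the
augmentation ideal. -/
def congruenceSubgroup (V : Submodule K (MonoidAlgebra K F)) (hV : augmentation K F * V ≤ V) :
    Subgroup F where
  carrier := {f | MonoidAlgebra.of K F f - 1 ∈ V}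
  one_mem' := by rw [Set.mem_ofPred_eq, map_one, sub_self]; exact zero_mem _
  mul_mem' := by
    intro f g hf hg
    have : MonoidAlgebra.of K F (f * g) - 1 =
        (MonoidAlgebra.of K F f - 1) * (MonoidAlgebra.of K F g - 1) +
          (MonoidAlgebra.of K F f - 1) + (MonoidAlgebra.of K F g - 1) := by
      rw [map_mul]; simp only [sub_mul, mul_sub, one_mul, mul_one]; abel
    rw [Set.mem_ofPred_eq, this]
    exact add_mem (add_mem
      (hV (Submodule.mul_mem_mul (of_sub_one_mem_augmentation K f) hg)) hf) hg
  inv_mem' := by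
    intro f hf
    have : MonoidAlgebra.of K F f⁻¹ - 1 =
        -((MonoidAlgebra.of K F f⁻¹ - 1) * (MonoidAlgebra.of K F f - 1) +
          (MonoidAlgebra.of K F f - 1)) := by
      have h : MonoidAlgebra.of K F f⁻¹ * MonoidAlgebra.of K F f = 1 := by
        rw [← map_mul, inv_mul_cancel, map_one]
      simp only [sub_mul, mul_sub, one_mul, mul_one, h]; abel
    rw [Set.mem_ofPred_eq, this]
    exact neg_mem (add_mem
      (hV (Submodule.mul_mem_mul (of_sub_one_mem_augmentation K _) hf)) hf)

end Augmentation

section Extension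

variable {G : Type*} [Group G] {F : Subgroup G} [F.Normal] {K : Type*} [CommRing K]

theorem commutator_map_congruenceSubgroup_le {V V' : Submodule K (MonoidAlgebra K F)}
    (hV : augmentation K F * V ≤ V) (hV' : augmentation K F * V' ≤ V')
    (hV'r : V' * augmentation K F ≤ V')
    (hact : ∀ g : G, ∀ z ∈ V, autAlgHom K (MulAut.conjNormal g) z - z ∈ V') :
    ⁅(congruenceSubgroup V hV).map F.subtype, (⊤ : Subgroup G)⁆ ≤
      (congruenceSubgroup V' hV').map F.subtype := by
  rw [Subgroup.commutator_le]
  rintro _ ⟨f, hf, rfl⟩ g -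
  refine ⟨f * (MulAut.conjNormal g f)⁻¹, ?_, ?_⟩
  · set f' : F := MulAut.conjNormal g f with hf'
    set u := MonoidAlgebra.of K F f - 1 with hu
    set y := autAlgHom K (MulAut.conjNormal g) u - u with hy
    have hy' : MonoidAlgebra.of K F f - MonoidAlgebra.of K F f' = -y := by
      rw [hy, hu, map_sub, map_one, autAlgHom_of]; abel
    have : MonoidAlgebra.of K F (f * f'⁻¹) - 1 = -(y * (MonoidAlgebra.of K F f'⁻¹ - 1) + y) := by
      have h : MonoidAlgebra.of K F f' * MonoidAlgebra.of K F f'⁻¹ = 1 := by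
        rw [← map_mul, mul_inv_cancel, map_one]
      rw [mul_sub, mul_one, sub_add_cancel, ← neg_mul, ← hy', sub_mul, h, map_mul]
    show MonoidAlgebra.of K F (f * f'⁻¹) - 1 ∈ V'
    rw [this]
    have hyV : y ∈ V' := hact g u hf
    exact neg_mem (add_mem
      (hV'r (Submodule.mul_mem_mul hyV (of_sub_one_mem_augmentation K _))) hyV)
  · simp [commutatorElement_def, MulAut.conjNormal_apply, mul_assoc]

theorem autAlgHom_conjNormal_sub_self_mem (f : F) {k : ℕ} {z : MonoidAlgebra K F}
    (hz : z ∈ augmentation K F ^ k) :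
    autAlgHom K (MulAut.conjNormal (f : G)) z - z ∈ augmentation K F ^ (k + 1) := by
  refine autAlgHom_sub_self_mem _ (fun x => ?_) hz
  rw [map_sub, map_one, autAlgHom_of]
  set a := MonoidAlgebra.of K F f with ha
  set b := MonoidAlgebra.of K F x with hb
  set c := MonoidAlgebra.of K F f⁻¹ with hc
  have hac : a * c = 1 := by rw [ha, hc, ← map_mul, mul_inv_cancel, map_one]
  have hx : MulAut.conjNormal (f : G) x = f * x * f⁻¹ := by ext; simp [MulAut.conjNormal_apply]
  have h2 : (a - 1) * (b - 1) - (b - 1) * (a - 1) ∈ augmentation K F ^ 2 := by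
    rw [pow_two]
    exact sub_mem (Submodule.mul_mem_mul (of_sub_one_mem_augmentation K _)
      (of_sub_one_mem_augmentation K _)) (Submodule.mul_mem_mul (of_sub_one_mem_augmentation K _)
      (of_sub_one_mem_augmentation K _))
  have h3 : MonoidAlgebra.of K F (MulAut.conjNormal (f : G) x) - 1 - (b - 1) =
      ((a - 1) * (b - 1) - (b - 1) * (a - 1)) * (c - 1) +
        ((a - 1) * (b - 1) - (b - 1) * (a - 1)) := by
    rw [hx, map_mul, map_mul, ← ha, ← hb, ← hc]
    simp only [sub_mul, mul_sub, one_mul, mul_one, mul_assoc, hac]; abel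
  rw [h3]
  refine add_mem (augmentation_pow_succ_le two_ne_zero ?_) h2
  rw [pow_succ]
  exact Submodule.mul_mem_mul h2 (of_sub_one_mem_augmentation K _)

theorem autAlgHom_zpow_sub_self_mem {F : Type*} [Group F] {φ : MulAut F}
    {V V' : Submodule K (MonoidAlgebra K F)}
    (hstab : ∀ s : ℤ, ∀ z ∈ V', autAlgHom K (φ ^ s) z ∈ V')
    (hφ : ∀ z ∈ V, autAlgHom K φ z - z ∈ V') (s : ℤ) {z : MonoidAlgebra K F} (hz : z ∈ V) :
    autAlgHom K (φ ^ s) z - z ∈ V' := by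
  induction s using Int.induction_on with
  | zero => simp [autAlgHom_one]
  | succ s ih =>
    have := add_mem (hstab s _ (hφ z hz)) ih
    rwa [map_sub, ← autAlgHom_mul_apply, ← zpow_add_one, sub_add_sub_cancel] at this
  | pred s ih =>
    have := sub_mem ih (hstab (-s - 1) _ (hφ z hz))
    rw [map_sub, ← autAlgHom_mul_apply, ← zpow_add_one, sub_add_cancel] at this
    convert this using 1
    abel

theorem exists_lowerCentralSeries_le {b : G} (hb : ∀ g : G, ∃ f : F, ∃ s : ℤ, g = f * b ^ s)
    {q : ℕ} (hq : ∀ k, ∀ z ∈ augmentation K F ^ k,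
      (((autAlgHom K (MulAut.conjNormal b : MulAut F)).toLinearMap - 1) ^ q) z ∈
        augmentation K F ^ (k + 1)) {k : ℕ} (hk : k ≠ 0) :
    ∃ N, ∀ g ∈ (⊤ : Subgroup G).lowerCentralSeries N,
      ∃ f : F, g = f ∧ MonoidAlgebra.of K F f - 1 ∈ augmentation K F ^ k := by
  set T : Module.End K (MonoidAlgebra K F) :=
    (autAlgHom K (MulAut.conjNormal b : MulAut F)).toLinearMap - 1 with hT
  induction k, Nat.one_le_iff_ne_zero.2 hk using Nat.le_induction with
  | base =>
    refine ⟨1, fun g hg => ?_⟩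
    have hle : (⊤ : Subgroup G).lowerCentralSeries 1 ≤ F := by
      rw [Subgroup.lowerCentralSeries_succ, Subgroup.lowerCentralSeries_zero,
        Subgroup.commutator_le]
      intro x _ y _
      obtain ⟨f, s, rfl⟩ := hb x
      obtain ⟨f', s', rfl⟩ := hb y
      rw [← QuotientGroup.eq_one_iff]
      have h1 : ∀ f : F, ((f : G) : G ⧸ F) = 1 := fun f =>
        (QuotientGroup.eq_one_iff _).2 f.2
      simp only [commutatorElement_def, QuotientGroup.mk_mul, QuotientGroup.mk_inv,
        QuotientGroup.mk_zpow, h1, one_mul]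
      group
    exact ⟨⟨g, hle hg⟩, rfl, by simpa using of_sub_one_mem_augmentation K _⟩
  | succ k hk1 ih =>
    have hk0 : k ≠ 0 := Nat.one_le_iff_ne_zero.1 hk1
    obtain ⟨N, hN⟩ := ih hk0
    let W (t : ℕ) : Submodule K (MonoidAlgebra K F) :=
      augmentation K F ^ k ⊓ (augmentation K F ^ (k + 1)).comap (T ^ t)
    have hle : ∀ t, augmentation K F ^ (k + 1) ≤ W t := fun t z hz =>
      ⟨augmentation_pow_succ_le hk0 hz, pow_apply_mem_augmentation_pow t hz⟩
    have hWl : ∀ t, augmentation K F * W t ≤ W t := fun t => by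
      refine le_trans ?_ (hle t)
      rw [pow_succ']
      exact mul_le_mul' le_rfl inf_le_left
    have hWr : ∀ t, W t * augmentation K F ≤ W t := fun t => by
      refine le_trans ?_ (hle t)
      rw [pow_succ]
      exact mul_le_mul' inf_le_left le_rfl
    have hstab : ∀ (t : ℕ) (s : ℤ), ∀ z ∈ W t,
        autAlgHom K ((MulAut.conjNormal b : MulAut F) ^ s) z ∈ W t := by
      rintro t s z ⟨hz, hz'⟩
      refine ⟨autAlgHom_mem _ hz, ?_⟩
      have hcomm : Commute (autAlgHom K ((MulAut.conjNormal b : MulAut F) ^ s)).toLinearMap T := by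
        refine Commute.sub_right ?_ (Commute.one_right _)
        refine LinearMap.ext fun z => ?_
        show autAlgHom K (_ ^ s) (autAlgHom K (MulAut.conjNormal b) z) =
          autAlgHom K (MulAut.conjNormal b) (autAlgHom K (_ ^ s) z)
        rw [← autAlgHom_mul_apply, ← autAlgHom_mul_apply, ← zpow_add_one, ← zpow_one_add, add_comm]
      have := LinearMap.congr_fun (hcomm.pow_right t).eq z
      rw [SetLike.mem_coe, Submodule.mem_comap]
      exact this ▸ autAlgHom_mem _ hz'
    have hact : ∀ (t : ℕ) (g : G), ∀ z ∈ W (t + 1),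
        autAlgHom K (MulAut.conjNormal g) z - z ∈ W t := by
      intro t g z hz
      obtain ⟨f, s, rfl⟩ := hb g
      rw [map_mul, autAlgHom_mul_apply, map_zpow]
      set y := autAlgHom K ((MulAut.conjNormal b : MulAut F) ^ s) z with hy
      have h1 : y - z ∈ W t := autAlgHom_zpow_sub_self_mem (hstab t) (fun z hz => by
        refine ⟨sub_mem (autAlgHom_mem _ hz.1) hz.1, ?_⟩
        have := hz.2
        rwa [SetLike.mem_coe, Submodule.mem_comap, pow_succ] at this) s hz
      rw [← sub_add_sub_cancel _ y z]
      exact add_mem (hle t (autAlgHom_conjNormal_sub_self_mem f (autAlgHom_mem _ hz.1))) h1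
    have key : ∀ t ≤ q, (⊤ : Subgroup G).lowerCentralSeries (N + t) ≤
        (congruenceSubgroup (W (q - t)) (hWl _)).map F.subtype := by
      intro t
      induction t with
      | zero =>
        intro _ g hg
        obtain ⟨f, rfl, hf⟩ := hN g hg
        exact ⟨f, ⟨hf, hq k _ hf⟩, rfl⟩
      | succ t iht =>
        intro ht
        rw [← add_assoc, Subgroup.lowerCentralSeries_succ]
        refine le_trans (Subgroup.commutator_mono (iht (by omega)) le_rfl) ?_
        refine commutator_map_congruenceSubgroup_le _ _ (hWr _) fun g z hz => hact _ g z ?_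
        rwa [show q - (t + 1) + 1 = q - t by omega]
    refine ⟨N + q, fun g hg => ?_⟩
    obtain ⟨f, hf, rfl⟩ := key q le_rfl hg
    rw [Nat.sub_self] at hf
    exact ⟨f, rfl, hf.2⟩

end Extension

theorem sub_one_pow_apply_mem_of_abelianization {K F : Type*} [CommRing K] [Group F] {M : ℕ}
    (hM : (M : K) = 0) {φ : MulAut F} {α : AddMonoid.End (Additive (Abelianization F))}
    (hα : ∀ x, α (Additive.ofMul (Abelianization.of x)) =
      Additive.ofMul (Abelianization.of (φ x))) {m : ℕ}
    (hpow : ∀ v, ∃ w, ((α - 1) ^ m) v = M • w) (f : F) :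
    (((autAlgHom K φ).toLinearMap - 1) ^ m) (MonoidAlgebra.of K F f - 1) ∈
      augmentation K F ^ 2 := by
  let π := (augmentation K F ^ 2).mkQ
  have hπ : ∀ z ∈ augmentation K F ^ 2, π z = 0 := fun z hz =>
    (Submodule.Quotient.mk_eq_zero _).2 hz
  let δ₀ : F →* Multiplicative (MonoidAlgebra K F ⧸ augmentation K F ^ 2) :=
    { toFun := fun f => Multiplicative.ofAdd (π (MonoidAlgebra.of K F f - 1))
      map_one' := by rw [map_one, sub_self, map_zero, ofAdd_zero]
      map_mul' := fun f g => by
        rw [← ofAdd_add, ← map_add]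
        congr 1
        rw [← sub_eq_zero, ← map_sub]
        apply hπ
        have : MonoidAlgebra.of K F (f * g) - 1 -
            (MonoidAlgebra.of K F f - 1 + (MonoidAlgebra.of K F g - 1)) =
            (MonoidAlgebra.of K F f - 1) * (MonoidAlgebra.of K F g - 1) := by
          rw [map_mul]; simp only [sub_mul, mul_sub, one_mul, mul_one]; abel
        rw [this, pow_two]
        exact Submodule.mul_mem_mul (of_sub_one_mem_augmentation K _)
          (of_sub_one_mem_augmentation K _) }
  let δ : Additive (Abelianization F) →+ MonoidAlgebra K F ⧸ augmentation K F ^ 2 :=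
    MonoidHom.toAdditiveLeft (Abelianization.lift δ₀)
  have hδ : ∀ x, δ (Additive.ofMul (Abelianization.of x)) = π (MonoidAlgebra.of K F x - 1) :=
    fun x => by
      show Multiplicative.toAdd (Abelianization.lift δ₀ (Abelianization.of x)) = _
      rw [Abelianization.lift_apply_of]; rfl
  set T : Module.End K (MonoidAlgebra K F) := (autAlgHom K φ).toLinearMap - 1 with hT
  have hstep : ∀ j v r, π r = δ v → π ((T ^ j) r) = δ (((α - 1) ^ j) v) := by
    intro j
    induction j with
    | zero => intro v r h; simpa using h
    | succ j ih =>
      intro v r h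
      rw [pow_succ T, pow_succ (α - 1), Module.End.mul_apply, AddMonoid.End.coe_mul,
        Function.comp_apply]
      apply ih
      obtain ⟨x, rfl⟩ : ∃ x, Additive.ofMul (Abelianization.of x) = v :=
        ⟨_, (QuotientGroup.mk_surjective v.toMul).choose_spec⟩
      rw [hδ, ← sub_eq_zero, ← map_sub] at h
      have h0 : r - (MonoidAlgebra.of K F x - 1) ∈ augmentation K F ^ 2 :=
        (Submodule.Quotient.mk_eq_zero _).1 h
      have h1 := hπ _ (pow_apply_mem_augmentation_pow (φ := φ) 1 h0)
      rw [pow_one, ← hT, map_sub T, map_sub π, sub_eq_zero] at h1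
      rw [h1, show (α - 1) (Additive.ofMul (Abelianization.of x)) =
        α (Additive.ofMul (Abelianization.of x)) - Additive.ofMul (Abelianization.of x) from rfl,
        map_sub δ, hα, hδ, hδ, ← map_sub π]
      congr 1
      rw [hT, LinearMap.sub_apply, Module.End.one_apply, AlgHom.toLinearMap_apply, map_sub, map_one,
        autAlgHom_of]
  have h := hstep m _ _ (hδ f).symm
  obtain ⟨w, hw⟩ := hpow (Additive.ofMul (Abelianization.of f))
  rw [hw, map_nsmul, ← Nat.cast_smul_eq_nsmul K, hM, zero_smul] at h
  exact (Submodule.Quotient.mk_eq_zero _).1 h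

theorem transfiniteLCS_natCast (G : Type*) [Group G] (n : ℕ) :
    transfiniteLCS G n = (⊤ : Subgroup G).lowerCentralSeries n := by
  induction n with
  | zero => simp [transfiniteLCS]
  | succ n ih =>
    rw [Subgroup.lowerCentralSeries_succ, ← ih, Nat.cast_succ, transfiniteLCS,
      Ordinal.limitRecOn_add_one]
    rfl

theorem transfiniteLCS_le_of_isSuccLimit (G : Type*) [Group G] {o o' : Ordinal}
    (ho : Order.IsSuccLimit o) (h : o' < o) : transfiniteLCS G o ≤ transfiniteLCS G o' := by
  rw [transfiniteLCS, Ordinal.limitRecOn_limit _ _ _ _ ho]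
  exact iInf₂_le o' h

/-- If `G` is an extension of a free group `F` of finite rank `n ≥ 2` by an
infinite cyclic group `⟨a⟩` and the induced endomorphism `α` of `A = F/[F,F]` satisfies
`(α − id)^m(A) ⊆ M·A` for some `m` and `M ≥ 2`, then `γ_{ω²}(G) = 1`. -/
theorem stmt13 {G : Type*} [Group G] (F : Subgroup G) (hN : F.Normal) (n : ℕ) (hn : 2 ≤ n)
    (e : ↥F ≃* FreeGroup (Fin n)) (a : G)
    (ha_inf : ¬ IsOfFinOrder (QuotientGroup.mk a : G ⧸ F))
    (ha_gen : ∀ g : G ⧸ F, ∃ k : ℤ, g = (QuotientGroup.mk a : G ⧸ F) ^ k)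
    (α : AddMonoid.End (Additive (Abelianization ↥F)))
    (hα : ∀ x : ↥F,
      α (Additive.ofMul (Abelianization.of x)) =
        Additive.ofMul (Abelianization.of
          (⟨a⁻¹ * ↑x * a, by simpa using hN.conj_mem _ x.2 a⁻¹⟩ : ↥F)))
    (m M : ℕ) (hM : 2 ≤ M)
    (hpow : ∀ v : Additive (Abelianization ↥F), ∃ w, ((α - 1) ^ m) v = M • w) :
    transfiniteLCS G (Ordinal.omega0 ^ 2) = ⊥ := by
  obtain ⟨p, hp, hpM⟩ := Nat.exists_prime_and_dvd (show M ≠ 1 by omega)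
  have : Fact p.Prime := ⟨hp⟩
  have hMp : (M : ZMod p) = 0 := (ZMod.natCast_eq_zero_iff M p).2 hpM
  have hα' : ∀ x : F, α (Additive.ofMul (Abelianization.of x)) =
      Additive.ofMul (Abelianization.of ((MulAut.conjNormal a⁻¹ : MulAut F) x)) := fun x => by
    rw [hα]
    congr 2
    ext
    simp
  obtain ⟨q, hq⟩ := exists_pow_apply_mem_augmentation_pow_succ p
    (sub_one_pow_apply_mem_of_abelianization hMp hα' hpow)
  have hb : ∀ g : G, ∃ f : F, ∃ s : ℤ, g = f * a⁻¹ ^ s := fun g => by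
    obtain ⟨k, hk⟩ := ha_gen g
    rw [← QuotientGroup.mk_zpow, eq_comm, QuotientGroup.eq] at hk
    have := hN.conj_mem _ hk (a ^ k)
    exact ⟨⟨_, this⟩, -k, by simp⟩
  rw [eq_bot_iff]
  intro g hg
  have hmem : ∀ k ≠ 0, ∃ f : F, g = f ∧
      MonoidAlgebra.of (ZMod p) F f - 1 ∈ augmentation (ZMod p) F ^ k := fun k hk => by
    obtain ⟨N, hN'⟩ := exists_lowerCentralSeries_le hb hq hk
    apply hN'
    rw [← transfiniteLCS_natCast]
    refine transfiniteLCS_le_of_isSuccLimit G ?_ ?_ hg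
    · rw [pow_two]
      exact Ordinal.isSuccLimit_mul_right Ordinal.omega0_pos Ordinal.isSuccLimit_omega0
    · refine (Ordinal.natCast_lt_omega0 N).trans_le ?_
      rw [pow_two]
      exact Ordinal.le_mul_left _ Ordinal.omega0_pos
  obtain ⟨f, rfl, -⟩ := hmem 1 one_ne_zero
  have hf : f = 1 := by
    refine eq_one_of_forall_mem_augmentation_pow (ZMod p) e fun k hk => ?_
    obtain ⟨f', hff', hf'⟩ := hmem k hk
    rwa [Subtype.ext hff']
  rw [hf, Subgroup.mem_bot, Subgroup.coe_one]
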